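/- arXiv:1511.08718 — 2 statements merged into one kernel-verified Lean document; each statement's English description precedes it below -/
import Mathlib

section
/- Let ξ, σ ∈ ℂ, u ∈ ℂ, t ∈ ℝ, and let d ∈ ℂ satisfy d² = ξ² + σ²(u² + iu). Set g₂ := (ξ−d)/(ξ+d) and A₂ := d·cosh(dt/2) + ξ·sinh(dt/2), and assume ξ + d ≠ 0 and A₂ ≠ 0. Then 1 − g₂·e^{−dt} ≠ 0 and (ξ − d)·(1 − e^{−dt})/(1 − g₂·e^{−dt}) = −σ²·(u² + iu)·sinh(dt/2)/A₂. (This identifies the v₀-coefficient in the Schoutens representation of the Heston characteristic function with −σ²·A, where A := (u²+iu)·sinh(dt/2)/A₂.) -/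
/-- The `v₀`-coefficient in the Schoutens representation of the Heston characteristic
function equals `−σ²·A` with `A := (u²+iu)·sinh(dt/2)/A₂`. -/
theorem schoutens_v0_coefficient (ξ σ u : ℂ) (t : ℝ) (d : ℂ)
    (hd : d ^ 2 = ξ ^ 2 + σ ^ 2 * (u ^ 2 + Complex.I * u))
    (g₂ A₂ : ℂ)
    (hg₂ : g₂ = (ξ - d) / (ξ + d))
    (hA₂ : A₂ = d * Complex.cosh (d * (t : ℂ) / 2) + ξ * Complex.sinh (d * (t : ℂ) / 2))
    (hp : ξ + d ≠ 0) (hA₂0 : A₂ ≠ 0) :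
    1 - g₂ * Complex.exp (-(d * (t : ℂ))) ≠ 0 ∧
      (ξ - d) * (1 - Complex.exp (-(d * (t : ℂ)))) / (1 - g₂ * Complex.exp (-(d * (t : ℂ)))) =
        -σ ^ 2 * (u ^ 2 + Complex.I * u) * Complex.sinh (d * (t : ℂ) / 2) / A₂ := by
  have hF : Complex.exp (-(d * t / 2)) ≠ 0 := Complex.exp_ne_zero _
  have hEF : Complex.exp (d * t / 2) * Complex.exp (-(d * t / 2)) = 1 := by
    rw [← Complex.exp_add, add_neg_cancel, Complex.exp_zero]
  have hsq : Complex.exp (-(d * t)) = Complex.exp (-(d * t / 2)) ^ 2 := by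
    rw [← Complex.exp_nat_mul]
    congr 1
    push_cast
    ring
  rw [Complex.cosh, Complex.sinh] at hA₂
  rw [hsq, Complex.sinh]
  generalize Complex.exp (d * t / 2) = E at *
  generalize Complex.exp (-(d * t / 2)) = F at *
  have hden : 1 - g₂ * F ^ 2 = 2 * F * A₂ / (ξ + d) := by
    rw [hg₂, hA₂]
    field_simp
    linear_combination (-(ξ + d)) * hEF
  rw [hden]
  refine ⟨div_ne_zero (mul_ne_zero (mul_ne_zero two_ne_zero hF) hA₂0) hp, ?_⟩
  field_simp
  linear_combination (-(1 - F ^ 2)) * hd + σ ^ 2 * (u ^ 2 + Complex.I * u) * hEF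
end

section
/- Fix real κ, σ, t with σ ≠ 0, t > 0, and u ∈ ℂ, and for ρ ∈ ℝ define ξ(ρ) := κ − σρiu, d(ρ) := (ξ(ρ)² + σ²(u²+iu))^{1/2} (principal square root), and A₂(ρ) := d(ρ)·cosh(d(ρ)t/2) + ξ(ρ)·sinh(d(ρ)t/2). If at ρ₀ the radicand ξ(ρ₀)² + σ²(u²+iu) does not lie in (−∞, 0], then ρ ↦ A₂(ρ) is differentiable at ρ₀ with derivative ∂A₂/∂ρ = − σ·iu·(2 + t·ξ(ρ₀)) · ( ξ(ρ₀)·cosh(d(ρ₀)t/2) + d(ρ₀)·sinh(d(ρ₀)t/2) ) / (2·d(ρ₀)). -/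
noncomputable section

/-- Principal complex square root `z^{1/2} := exp((1/2)·Log z)`. -/
def csqrt (z : ℂ) : ℂ := Complex.exp ((1 / 2 : ℂ) * Complex.log z)

/-- `ξ(ρ) := κ − σρiu`. -/
def ξf (κ σ : ℝ) (u : ℂ) (ρ : ℝ) : ℂ := (κ : ℂ) - (σ : ℂ) * (ρ : ℂ) * Complex.I * u

/-- `d(ρ) := (ξ(ρ)² + σ²(u²+iu))^{1/2}` (principal square root). -/
def df (κ σ : ℝ) (u : ℂ) (ρ : ℝ) : ℂ :=
  csqrt ((ξf κ σ u ρ) ^ 2 + (σ : ℂ) ^ 2 * (u ^ 2 + Complex.I * u))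

/-- `A₂(ρ) := d(ρ)·cosh(d(ρ)t/2) + ξ(ρ)·sinh(d(ρ)t/2)`. -/
def A₂f (κ σ t : ℝ) (u : ℂ) (ρ : ℝ) : ℂ :=
  df κ σ u ρ * Complex.cosh (df κ σ u ρ * (t : ℂ) / 2) +
    ξf κ σ u ρ * Complex.sinh (df κ σ u ρ * (t : ℂ) / 2)

theorem csqrt_sq {z : ℂ} (hz : z ≠ 0) : csqrt z ^ 2 = z := by
  rw [csqrt, ← Complex.exp_nat_mul]
  convert Complex.exp_log hz using 2
  push_cast
  ring

theorem csqrt_ne_zero (z : ℂ) : csqrt z ≠ 0 := Complex.exp_ne_zero _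

theorem hasDerivAt_csqrt {z : ℂ} (hz : z ∈ Complex.slitPlane) :
    HasDerivAt csqrt (1 / (2 * csqrt z)) z := by
  have hz0 : z ≠ 0 := Complex.slitPlane_ne_zero hz
  have h : HasDerivAt csqrt (csqrt z * ((1 / 2 : ℂ) * z⁻¹)) z :=
    ((Complex.hasDerivAt_log hz).const_mul (1 / 2 : ℂ)).cexp
  convert h using 1
  have hs := csqrt_sq hz0
  have hd := csqrt_ne_zero z
  field_simp
  linear_combination -hs

theorem hasDerivAt_ξf (κ σ : ℝ) (u : ℂ) (ρ : ℝ) :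
    HasDerivAt (ξf κ σ u) (-((σ : ℂ) * Complex.I * u)) ρ := by
  have h := ((((Complex.ofRealCLM.hasDerivAt (x := ρ)).const_mul (σ : ℂ)).mul_const
    Complex.I).mul_const u).const_sub (κ : ℂ)
  refine h.congr_deriv ?_
  simp

theorem hasDerivAt_df (κ σ : ℝ) (u : ℂ) (ρ : ℝ)
    (hw : (ξf κ σ u ρ) ^ 2 + (σ : ℂ) ^ 2 * (u ^ 2 + Complex.I * u) ∈ Complex.slitPlane) :
    HasDerivAt (df κ σ u) (-((σ : ℂ) * Complex.I * u) * ξf κ σ u ρ / df κ σ u ρ) ρ := by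
  have hr := ((hasDerivAt_ξf κ σ u ρ).pow 2).add_const ((σ : ℂ) ^ 2 * (u ^ 2 + Complex.I * u))
  have h := (hasDerivAt_csqrt hw).comp ρ hr
  refine h.congr_deriv ?_
  have hd : df κ σ u ρ ≠ 0 := csqrt_ne_zero _
  change 1 / (2 * df κ σ u ρ) * _ = _
  field_simp
  push_cast
  ring

/-- `∂A₂/∂ρ = −σiu(2+tξ)(ξ·cosh(dt/2)+d·sinh(dt/2))/(2d)` whenever the radicand avoids
`(−∞,0]`. -/
theorem hasDerivAt_A₂_rho (κ σ t : ℝ) (hσ : σ ≠ 0) (ht : 0 < t) (u : ℂ) (ρ₀ : ℝ)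
    (hw : (ξf κ σ u ρ₀) ^ 2 + (σ : ℂ) ^ 2 * (u ^ 2 + Complex.I * u) ∈ Complex.slitPlane) :
    HasDerivAt (A₂f κ σ t u)
      (-((σ : ℂ) * Complex.I * u * (2 + (t : ℂ) * ξf κ σ u ρ₀)) *
        (ξf κ σ u ρ₀ * Complex.cosh (df κ σ u ρ₀ * (t : ℂ) / 2) +
          df κ σ u ρ₀ * Complex.sinh (df κ σ u ρ₀ * (t : ℂ) / 2)) / (2 * df κ σ u ρ₀)) ρ₀ := by
  have hd : df κ σ u ρ₀ ≠ 0 := csqrt_ne_zero _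
  have hξ' := hasDerivAt_ξf κ σ u ρ₀
  have hd' := hasDerivAt_df κ σ u ρ₀ hw
  have harg := (hd'.mul_const (t : ℂ)).div_const 2
  have hcosh := (Complex.hasDerivAt_cosh (df κ σ u ρ₀ * (t : ℂ) / 2)).comp ρ₀ harg
  have hsinh := (Complex.hasDerivAt_sinh (df κ σ u ρ₀ * (t : ℂ) / 2)).comp ρ₀ harg
  refine ((hd'.mul hcosh).add (hξ'.mul hsinh)).congr_deriv ?_
  simp only [Function.comp_apply]
  field_simp
  ring
end
end
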